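/- Let n ≥ 1, let Q : ℝ^n × ℝ^n → ℝ^n be bilinear, and for u ∈ ℝ^n let Q_u(x,y) := Q(x,y) + (u_1 x_1 y_1, …, u_n x_n y_n). Define F(s) := ∫_0^1 |s|^{-1+ρ} ρ^{2n} dρ. Then for Lebesgue-almost every u ∈ ℝ^n, ∫_{[-1,1]^n} F(|det Q_u(·, t)|) dt < ∞, where det Q_u(·,t) is the determinant of the linear map v ↦ Q_u(v,t). -/

import Mathlib

open MeasureTheory
open scoped ENNReal

/-- `F(s) = ∫₀¹ |s|^{-1+ρ} ρ^{2n} dρ`, valued in `[0,∞]` (so `F(0) = ∞` is permitted). -/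
noncomputable def Fint (n : ℕ) (s : ℝ) : ℝ≥0∞ :=
  ∫⁻ ρ in Set.Ioo (0 : ℝ) 1, ENNReal.ofReal |s| ^ (-1 + ρ) * ENNReal.ofReal (ρ ^ (2 * n))

/-- The linear map `v ↦ Q_u(v, t)`, where `Q_u(x,y) = Q(x,y) + (u₁x₁y₁, …, uₙxₙyₙ)`. -/
noncomputable def QuFlip {n : ℕ} (Q : (Fin n → ℝ) →ₗ[ℝ] (Fin n → ℝ) →ₗ[ℝ] (Fin n → ℝ))
    (u t : Fin n → ℝ) : (Fin n → ℝ) →ₗ[ℝ] (Fin n → ℝ) :=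
  Q.flip t + LinearMap.pi fun i => (u i * t i) • LinearMap.proj i

theorem lintegral_pi_fin_succ {n : ℕ} (μ : Measure ℝ) [SigmaFinite μ]
    {f : (Fin (n + 1) → ℝ) → ℝ≥0∞} (hf : Measurable f) :
    ∫⁻ u, f u ∂(Measure.pi fun _ => μ)
      = ∫⁻ v, ∫⁻ x, f (Fin.cons x v) ∂μ ∂(Measure.pi fun _ : Fin n => μ) := by
  have h := (measurePreserving_piFinSuccAbove (fun _ : Fin (n + 1) => μ) 0).symm
  rw [← h.lintegral_comp hf, lintegral_prod_symm _ (by fun_prop)]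
  simp [MeasurableEquiv.piFinSuccAbove_symm_apply, Fin.insertNthEquiv]

theorem lintegral_pi_prod_fin (μ : Measure ℝ) [SigmaFinite μ] {g : ℝ → ℝ≥0∞}
    (hg : Measurable g) (n : ℕ) :
    ∫⁻ t, ∏ i, g (t i) ∂(Measure.pi fun _ : Fin n => μ) = (∫⁻ x, g x ∂μ) ^ n := by
  induction n with
  | zero => simp
  | succ n ih =>
    rw [lintegral_pi_fin_succ μ (by fun_prop)]
    simp only [Fin.prod_univ_succ, Fin.cons_zero, Fin.cons_succ]
    simp_rw [lintegral_mul_const _ hg]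
    rw [lintegral_const_mul _ (by fun_prop), ih, pow_succ']

theorem det_add_diagonal_cons {n : ℕ} (A : Matrix (Fin (n + 1)) (Fin (n + 1)) ℝ)
    (t : Fin (n + 1) → ℝ) (v : Fin n → ℝ) :
    ∃ b : ℝ, ∀ x : ℝ,
      (A + Matrix.diagonal fun i => (Fin.cons x v : Fin (n + 1) → ℝ) i * t i).det
        = (t 0 * (A.submatrix Fin.succ Fin.succ
            + Matrix.diagonal fun i => v i * t i.succ).det) * x + b := by
  have key (x : ℝ) (j : Fin (n + 1)) :
      (A + Matrix.diagonal fun i => (Fin.cons x v : Fin (n + 1) → ℝ) i * t i).submatrix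
          Fin.succ j.succAbove
        = (A + Matrix.diagonal fun i => (Fin.cons 0 v : Fin (n + 1) → ℝ) i * t i).submatrix
          Fin.succ j.succAbove := by
    ext a b
    simp [Matrix.diagonal_apply]
  refine ⟨(A + Matrix.diagonal fun i => (Fin.cons 0 v : Fin (n + 1) → ℝ) i * t i).det,
    fun x => ?_⟩
  have h0 : (A.submatrix Fin.succ Fin.succ + Matrix.diagonal fun i => v i * t i.succ)
      = (A + Matrix.diagonal fun i => (Fin.cons 0 v : Fin (n + 1) → ℝ) i * t i).submatrix
          Fin.succ (Fin.succAbove 0) := by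
    ext a b
    simp [Matrix.diagonal_apply]
  rw [h0, Matrix.det_succ_row_zero, Matrix.det_succ_row_zero (A + _)]
  simp_rw [key x]
  rw [Fin.sum_univ_succ, Fin.sum_univ_succ]
  simp [Matrix.diagonal_apply_ne']
  ring

theorem setLIntegral_abs_rpow_le {ρ : ℝ} (hρ : 0 < ρ) :
    ∫⁻ x in Set.Icc (-1 : ℝ) 1, ENNReal.ofReal |x| ^ (-1 + ρ) ≤ ENNReal.ofReal (2 / ρ) := by
  have hpos : ∫⁻ x in Set.Icc (0 : ℝ) 1, ENNReal.ofReal |x| ^ (-1 + ρ)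
      = ENNReal.ofReal (1 / ρ) := by
    rw [setLIntegral_congr (Ioc_ae_eq_Icc (a := (0 : ℝ)) (b := 1)).symm]
    have h1 : ∫⁻ x in Set.Ioc (0 : ℝ) 1, ENNReal.ofReal |x| ^ (-1 + ρ)
        = ∫⁻ x in Set.Ioc (0 : ℝ) 1, ENNReal.ofReal (x ^ (-1 + ρ)) :=
      setLIntegral_congr_fun measurableSet_Ioc fun x hx => by
        simp only [abs_of_pos hx.1, ENNReal.ofReal_rpow_of_pos hx.1]
    have hi : IntervalIntegrable (fun x : ℝ => x ^ (-1 + ρ)) volume 0 1 :=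
      intervalIntegral.intervalIntegrable_rpow' (by linarith)
    rw [h1, ← ofReal_integral_eq_lintegral_ofReal
      ((intervalIntegrable_iff_integrableOn_Ioc_of_le zero_le_one).1 hi)
      ((ae_restrict_iff' measurableSet_Ioc).2
        (.of_forall fun x hx => Real.rpow_nonneg hx.1.le _)),
      ← intervalIntegral.integral_of_le zero_le_one, integral_rpow (Or.inl (by linarith))]
    simp [hρ.ne']
  have hneg : ∫⁻ x in Set.Icc (-1 : ℝ) 0, ENNReal.ofReal |x| ^ (-1 + ρ)
      = ENNReal.ofReal (1 / ρ) := by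
    rw [← hpos, ← (Measure.measurePreserving_neg (volume : Measure ℝ)).setLIntegral_comp_preimage
      measurableSet_Icc (by fun_prop)]
    simp
  rw [← Set.Icc_union_Icc_eq_Icc (b := (0 : ℝ)) (by norm_num) (by norm_num)]
  refine (lintegral_union_le _ _ _).trans ?_
  rw [hpos, hneg, ← ENNReal.ofReal_add (by positivity) (by positivity)]
  apply ENNReal.ofReal_le_ofReal
  apply le_of_eq
  ring

theorem setLIntegral_abs_affine_rpow_le {ρ R : ℝ} (hρ : 0 < ρ) (hρ1 : ρ < 1) (hR : 0 ≤ R)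
    (a b : ℝ) :
    ∫⁻ x in Set.Icc (-R) R, ENNReal.ofReal |a * x + b| ^ (-1 + ρ)
      ≤ ENNReal.ofReal ((2 + 2 * R) / ρ) * ENNReal.ofReal |a| ^ (-1 + ρ) := by
  have hC : 0 < (2 + 2 * R) / ρ := by positivity
  rcases eq_or_ne a 0 with rfl | ha
  · rw [abs_zero, ENNReal.ofReal_zero, ENNReal.zero_rpow_of_neg (by linarith),
      ENNReal.mul_top (by simpa using hC)]
    exact le_top
  have hfac (x : ℝ) : ENNReal.ofReal |a * x + b| ^ (-1 + ρ)
      = ENNReal.ofReal |a| ^ (-1 + ρ) * ENNReal.ofReal |x + b / a| ^ (-1 + ρ) := by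
    rw [← ENNReal.mul_rpow_of_ne_top ENNReal.ofReal_ne_top ENNReal.ofReal_ne_top,
      ← ENNReal.ofReal_mul (abs_nonneg _), ← abs_mul]
    congr 3
    field_simp
  simp_rw [hfac]
  rw [lintegral_const_mul _ (by fun_prop), mul_comm]
  gcongr
  have hpt (y : ℝ) : ENNReal.ofReal |y| ^ (-1 + ρ)
      ≤ (Set.Icc (-1 : ℝ) 1).indicator (fun y => ENNReal.ofReal |y| ^ (-1 + ρ)) y + 1 := by
    by_cases hy : y ∈ Set.Icc (-1 : ℝ) 1
    · rw [Set.indicator_of_mem hy]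
      exact le_self_add
    · rw [Set.indicator_of_notMem hy, zero_add]
      have h1 : 1 < |y| := by
        by_contra! h
        exact hy (abs_le.1 h)
      exact ENNReal.rpow_le_one_of_one_le_of_neg (by simpa using h1.le) (by linarith)
  have hm : Measurable
      ((Set.Icc (-1 : ℝ) 1).indicator fun y => ENNReal.ofReal |y| ^ (-1 + ρ)) :=
    Measurable.indicator (by fun_prop) measurableSet_Icc
  calc ∫⁻ x in Set.Icc (-R) R, ENNReal.ofReal |x + b / a| ^ (-1 + ρ)
      ≤ ∫⁻ x in Set.Icc (-R) R, ((Set.Icc (-1 : ℝ) 1).indicator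
          (fun y => ENNReal.ofReal |y| ^ (-1 + ρ)) (x + b / a) + 1) :=
        lintegral_mono fun x => hpt _
    _ = (∫⁻ x in Set.Icc (-R) R, (Set.Icc (-1 : ℝ) 1).indicator
          (fun y => ENNReal.ofReal |y| ^ (-1 + ρ)) (x + b / a)) + ENNReal.ofReal (2 * R) := by
        rw [lintegral_add_right _ measurable_const]
        simp [two_mul]
    _ ≤ ENNReal.ofReal (2 / ρ) + ENNReal.ofReal (2 * R) := by
        gcongr
        refine (setLIntegral_le_lintegral _ _).trans ?_
        rw [lintegral_add_right_eq_self (μ := volume) ((Set.Icc (-1 : ℝ) 1).indicator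
          (fun y => ENNReal.ofReal |y| ^ (-1 + ρ))) (b / a),
          lintegral_indicator measurableSet_Icc]
        exact setLIntegral_abs_rpow_le hρ
    _ ≤ ENNReal.ofReal ((2 + 2 * R) / ρ) := by
        rw [← ENNReal.ofReal_add (by positivity) (by positivity)]
        apply ENNReal.ofReal_le_ofReal
        rw [add_div]
        gcongr
        rw [le_div_iff₀ hρ]
        nlinarith

theorem lintegral_abs_det_add_diagonal_rpow_le {ρ R : ℝ} (hρ : 0 < ρ) (hρ1 : ρ < 1)
    (hR : 0 ≤ R) {n : ℕ} (A : Matrix (Fin n) (Fin n) ℝ) (t : Fin n → ℝ) :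
    ∫⁻ u, ENNReal.ofReal |(A + Matrix.diagonal fun i => u i * t i).det| ^ (-1 + ρ)
        ∂(Measure.pi fun _ : Fin n => (volume : Measure ℝ).restrict (Set.Icc (-R) R))
      ≤ ∏ i, (ENNReal.ofReal ((2 + 2 * R) / ρ) * ENNReal.ofReal |t i| ^ (-1 + ρ)) := by
  induction n with
  | zero => simp
  | succ n ih =>
    have hm : Continuous fun u : Fin (n + 1) → ℝ =>
        (A + Matrix.diagonal fun i => u i * t i).det := by fun_prop
    have hm' : Continuous fun v : Fin n → ℝ => (A.submatrix Fin.succ Fin.succ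
        + Matrix.diagonal fun i => v i * t i.succ).det := by fun_prop
    have := hm.measurable
    have := hm'.measurable
    rw [lintegral_pi_fin_succ _ (by fun_prop), Fin.prod_univ_succ]
    refine le_trans ?_ (mul_le_mul_right (ih (A.submatrix Fin.succ Fin.succ)
      fun i => t i.succ) _)
    rw [← lintegral_const_mul _ (by fun_prop)]
    refine lintegral_mono fun v => ?_
    obtain ⟨b, hb⟩ := det_add_diagonal_cons A t v
    simp only [hb]
    refine (setLIntegral_abs_affine_rpow_le hρ hρ1 hR _ b).trans_eq ?_
    rw [mul_assoc, ← ENNReal.mul_rpow_of_ne_top ENNReal.ofReal_ne_top ENNReal.ofReal_ne_top,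
      ← ENNReal.ofReal_mul (abs_nonneg _), ← abs_mul]

theorem det_QuFlip {n : ℕ} (Q : (Fin n → ℝ) →ₗ[ℝ] (Fin n → ℝ) →ₗ[ℝ] (Fin n → ℝ))
    (u t : Fin n → ℝ) :
    LinearMap.det (QuFlip Q u t)
      = (LinearMap.toMatrix' (Q.flip t) + Matrix.diagonal fun i => u i * t i).det := by
  rw [← LinearMap.det_toMatrix', QuFlip, map_add]
  congr 2
  ext i j
  simp [LinearMap.toMatrix'_apply, Matrix.diagonal_apply, Pi.single_apply]

theorem continuous_det_QuFlip {n : ℕ}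
    (Q : (Fin n → ℝ) →ₗ[ℝ] (Fin n → ℝ) →ₗ[ℝ] (Fin n → ℝ)) :
    Continuous fun p : (Fin n → ℝ) × (Fin n → ℝ) => LinearMap.det (QuFlip Q p.1 p.2) := by
  simp_rw [det_QuFlip]
  have h : Continuous fun t : Fin n → ℝ => LinearMap.toMatrix' (Q.flip t) :=
    (LinearMap.toMatrix'.toLinearMap ∘ₗ Q.flip).continuous_of_finiteDimensional
  have h2 : Continuous fun p : (Fin n → ℝ) × (Fin n → ℝ) => LinearMap.toMatrix' (Q.flip p.2) :=
    h.comp continuous_snd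
  exact (h2.add (by fun_prop)).matrix_det

theorem measurable_Fint (n : ℕ) : Measurable (Fint n) := by
  unfold Fint
  exact Measurable.lintegral_prod_right'
    (f := fun p : ℝ × ℝ => ENNReal.ofReal |p.1| ^ (-1 + p.2) * ENNReal.ofReal (p.2 ^ (2 * n)))
    (by fun_prop)

theorem lintegral_lintegral_Fint_lt_top {n : ℕ}
    (Q : (Fin n → ℝ) →ₗ[ℝ] (Fin n → ℝ) →ₗ[ℝ] (Fin n → ℝ)) {R : ℝ} (hR : 0 ≤ R) :
    ∫⁻ u, (∫⁻ t in Set.Icc (-1 : Fin n → ℝ) 1, Fint n |LinearMap.det (QuFlip Q u t)|)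
        ∂(Measure.pi fun _ : Fin n => (volume : Measure ℝ).restrict (Set.Icc (-R) R)) < ⊤ := by
  have hc := (continuous_det_QuFlip Q).measurable
  have hF := measurable_Fint n
  set ν := Measure.pi fun _ : Fin n => (volume : Measure ℝ).restrict (Set.Icc (-R) R)
  have hbox : (volume : Measure (Fin n → ℝ)).restrict (Set.Icc (-1 : Fin n → ℝ) 1)
      = Measure.pi fun _ : Fin n => (volume : Measure ℝ).restrict (Set.Icc (-1) 1) := by
    rw [← Measure.restrict_pi_pi, Set.pi_univ_Icc]
    rfl
  have hbound {ρ : ℝ} (hρ : ρ ∈ Set.Ioo (0 : ℝ) 1) :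
      ∫⁻ t in Set.Icc (-1 : Fin n → ℝ) 1, ∫⁻ u,
        ENNReal.ofReal |LinearMap.det (QuFlip Q u t)| ^ (-1 + ρ)
          * ENNReal.ofReal (ρ ^ (2 * n)) ∂ν
      ≤ ENNReal.ofReal (((2 + 2 * R) * 2) ^ n) := by
    have h0 := hρ.1
    calc _ ≤ ∫⁻ t in Set.Icc (-1 : Fin n → ℝ) 1,
          (∏ i, (ENNReal.ofReal ((2 + 2 * R) / ρ) * ENNReal.ofReal |t i| ^ (-1 + ρ)))
            * ENNReal.ofReal (ρ ^ (2 * n)) := by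
          refine lintegral_mono fun t => ?_
          rw [lintegral_mul_const' _ _ ENNReal.ofReal_ne_top]
          gcongr
          simp_rw [det_QuFlip]
          exact lintegral_abs_det_add_diagonal_rpow_le hρ.1 hρ.2 hR _ t
      _ = (ENNReal.ofReal ((2 + 2 * R) / ρ)
            * ∫⁻ x in Set.Icc (-1 : ℝ) 1, ENNReal.ofReal |x| ^ (-1 + ρ)) ^ n
            * ENNReal.ofReal (ρ ^ (2 * n)) := by
          rw [lintegral_mul_const' _ _ ENNReal.ofReal_ne_top, hbox,
            lintegral_pi_prod_fin _ (g := fun x => ENNReal.ofReal ((2 + 2 * R) / ρ)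
              * ENNReal.ofReal |x| ^ (-1 + ρ)) (by fun_prop),
            lintegral_const_mul _ (by fun_prop)]
      _ ≤ (ENNReal.ofReal ((2 + 2 * R) / ρ) * ENNReal.ofReal (2 / ρ)) ^ n
            * ENNReal.ofReal (ρ ^ (2 * n)) := by
          gcongr
          exact setLIntegral_abs_rpow_le hρ.1
      _ = ENNReal.ofReal (((2 + 2 * R) * 2) ^ n) := by
          rw [← ENNReal.ofReal_mul (by positivity), ← ENNReal.ofReal_pow (by positivity),
            ← ENNReal.ofReal_mul (by positivity), pow_mul, ← mul_pow]
          congr 2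
          field_simp
  calc _ = ∫⁻ t in Set.Icc (-1 : Fin n → ℝ) 1, ∫⁻ u,
        Fint n |LinearMap.det (QuFlip Q u t)| ∂ν :=
        lintegral_lintegral_swap (by
          refine Measurable.aemeasurable ?_
          simp only [Function.uncurry_def]
          fun_prop)
    _ = ∫⁻ t in Set.Icc (-1 : Fin n → ℝ) 1, ∫⁻ ρ in Set.Ioo (0 : ℝ) 1, ∫⁻ u,
        ENNReal.ofReal |LinearMap.det (QuFlip Q u t)| ^ (-1 + ρ)
          * ENNReal.ofReal (ρ ^ (2 * n)) ∂ν := by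
        refine lintegral_congr fun t => ?_
        simp only [Fint, abs_abs]
        refine lintegral_lintegral_swap ?_
        have ht : Measurable fun p : (Fin n → ℝ) × ℝ => LinearMap.det (QuFlip Q p.1 t) :=
          hc.comp (measurable_fst.prodMk measurable_const)
        refine Measurable.aemeasurable ?_
        simp only [Function.uncurry_def]
        fun_prop
    _ = ∫⁻ ρ in Set.Ioo (0 : ℝ) 1, ∫⁻ t in Set.Icc (-1 : Fin n → ℝ) 1, ∫⁻ u,
        ENNReal.ofReal |LinearMap.det (QuFlip Q u t)| ^ (-1 + ρ)
          * ENNReal.ofReal (ρ ^ (2 * n)) ∂ν := by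
        refine lintegral_lintegral_swap (Measurable.aemeasurable ?_)
        have h3 : Measurable fun p : ((Fin n → ℝ) × ℝ) × (Fin n → ℝ) =>
            LinearMap.det (QuFlip Q p.2 p.1.1) :=
          hc.comp (by fun_prop : Measurable fun p : ((Fin n → ℝ) × ℝ) × (Fin n → ℝ) =>
            (p.2, p.1.1))
        exact Measurable.lintegral_prod_right'
          (f := fun p : ((Fin n → ℝ) × ℝ) × (Fin n → ℝ) =>
            ENNReal.ofReal |LinearMap.det (QuFlip Q p.2 p.1.1)| ^ (-1 + p.1.2)
              * ENNReal.ofReal (p.1.2 ^ (2 * n))) (by fun_prop)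
    _ ≤ ∫⁻ _ρ in Set.Ioo (0 : ℝ) 1, ENNReal.ofReal (((2 + 2 * R) * 2) ^ n) :=
        setLIntegral_mono measurable_const fun ρ hρ => hbound hρ
    _ < ⊤ := by simp

/-- for a.e. `u ∈ ℝⁿ`, `∫_{[-1,1]ⁿ} F(|det Q_u(·,t)|) dt < ∞`. -/
theorem ae_integral_F_finite (n : ℕ) (hn : 1 ≤ n)
    (Q : (Fin n → ℝ) →ₗ[ℝ] (Fin n → ℝ) →ₗ[ℝ] (Fin n → ℝ)) :
    ∀ᵐ u ∂(volume : Measure (Fin n → ℝ)),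
      (∫⁻ t in Set.Icc (-1 : Fin n → ℝ) 1, Fint n |LinearMap.det (QuFlip Q u t)|) < ⊤ := by
  have hmeas : Measurable fun u : Fin n → ℝ =>
      ∫⁻ t in Set.Icc (-1 : Fin n → ℝ) 1, Fint n |LinearMap.det (QuFlip Q u t)| := by
    have hc := (continuous_det_QuFlip Q).measurable
    have hF := measurable_Fint n
    exact Measurable.lintegral_prod_right'
      (f := fun p : (Fin n → ℝ) × (Fin n → ℝ) => Fint n |LinearMap.det (QuFlip Q p.1 p.2)|)
      (by fun_prop)
  have hN (N : ℕ) : ∀ᵐ u ∂(volume : Measure (Fin n → ℝ)),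
      u ∈ Set.univ.pi (fun _ : Fin n => Set.Icc (-(N : ℝ)) N) →
      (∫⁻ t in Set.Icc (-1 : Fin n → ℝ) 1, Fint n |LinearMap.det (QuFlip Q u t)|) < ⊤ := by
    rw [← ae_restrict_iff' (MeasurableSet.univ_pi fun _ => measurableSet_Icc), volume_pi,
      Measure.restrict_pi_pi]
    exact ae_lt_top hmeas (lintegral_lintegral_Fint_lt_top Q N.cast_nonneg).ne
  filter_upwards [ae_all_iff.2 hN] with u hu
  obtain ⟨N, hN⟩ := exists_nat_ge ‖u‖
  exact hu N fun i _ => abs_le.1 ((norm_le_pi_norm u i).trans hN)
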